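/- Let k ≥ 1, let f : G^k → ℂ be conjugacy invariant, and let γ₁, …, γ_k be closed loops in Λ. Let Σ have law μ_{Λ,β} and Ψ have law ν_{Λ,β}. Then E[f(Σ_{γ₁}, …, Σ_{γ_k})] = E[f(Ψ(ξ_{γ₁}), …, Ψ(ξ_{γ_k}))]. -/

import Mathlib

open Classical SimpleGraph
open scoped BigOperators

noncomputable section

namespace LGT

/-- A site of `ℤ⁴`. -/
abbrev Site : Type := Fin 4 → ℤ

/-- The `i`-th coordinate unit vector. -/
def unit (i : Fin 4) : Site := fun j => if j = i then 1 else 0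

lemma unit_apply_self (i : Fin 4) : unit i i = 1 := by simp [unit]

lemma unit_apply_nonneg (i j : Fin 4) : 0 ≤ unit i j := by
  by_cases h : j = i <;> simp [unit, h]

lemma unit_ne_zero (i : Fin 4) : unit i ≠ 0 := by
  intro h
  have h1 := congrFun h i
  rw [unit_apply_self] at h1
  exact one_ne_zero h1

/-- The lattice `Λ = ([a₁,b₁] × ⋯ × [a₄,b₄]) ∩ ℤ⁴`, with all side lengths equal. -/
structure Box where
  a : Fin 4 → ℤ
  b : Fin 4 → ℤ
  side_eq : ∀ i j : Fin 4, b i - a i = b j - a j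

/-- Membership of a site in the lattice `Λ`. -/
def Box.mem (Λ : Box) (x : Site) : Prop := ∀ i, Λ.a i ≤ x i ∧ x i ≤ Λ.b i

/-- The set of vertices `Λ₀` of the lattice. -/
abbrev VSite (Λ : Box) : Type := {x : Site // Λ.mem x}

lemma not_both {x y : Site} {i j : Fin 4} (h1 : y = x + unit i) (h2 : x = y + unit j) :
    False := by
  subst h1
  rw [add_assoc] at h2
  have h3 : unit i + unit j = 0 := left_eq_add.mp h2
  have h4 := congrFun h3 i
  rw [Pi.add_apply, Pi.zero_apply, unit_apply_self] at h4
  have h5 : (0:ℤ) ≤ unit j i := unit_apply_nonneg j i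
  omega

/-- The 1-skeleton `S₁(Λ)` of the lattice, as a graph on the vertices of `Λ`:
two vertices are adjacent iff they differ by a coordinate unit vector. -/
def latticeGraph (Λ : Box) : SimpleGraph (VSite Λ) where
  Adj u v := ∃ i : Fin 4, (v : Site) = (u : Site) + unit i ∨ (u : Site) = (v : Site) + unit i
  symm := by
    refine ⟨?_⟩
    rintro u v ⟨i, h | h⟩
    · exact ⟨i, Or.inr h⟩
    · exact ⟨i, Or.inl h⟩
  loopless := by
    refine ⟨?_⟩
    rintro u ⟨i, h | h⟩ <;> exact unit_ne_zero i (left_eq_add.mp h)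

/-- The set `Λ₁` of positively oriented nearest-neighbour edges of `Λ`:
an edge is a pair (base site, direction) whose endpoints both lie in `Λ`. -/
abbrev PEdge (Λ : Box) : Type :=
  {e : Site × Fin 4 // Λ.mem e.1 ∧ Λ.mem (e.1 + unit e.2)}

/-- The initial vertex of a positively oriented edge. -/
def PEdge.v0 {Λ : Box} (e : PEdge Λ) : VSite Λ := ⟨e.1.1, e.2.1⟩

/-- The final vertex of a positively oriented edge. -/
def PEdge.v1 {Λ : Box} (e : PEdge Λ) : VSite Λ := ⟨e.1.1 + unit e.1.2, e.2.2⟩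

/-- Edge configurations `σ ∈ G^{Λ₁}`. -/
abbrev EdgeConf (Λ : Box) (G : Type*) : Type _ := PEdge Λ → G

variable {G : Type*} [Group G]

/-- The value of an edge configuration on an oriented edge `(u, v)`:
`σ_e` on positively oriented edges, `σ_e⁻¹` on negatively oriented ones. -/
def oval {Λ : Box} (σ : EdgeConf Λ G) (u v : VSite Λ) : G :=
  if h : ∃ i : Fin 4, (v : Site) = (u : Site) + unit i then
    σ ⟨((u : Site), h.choose), u.2, by rw [← h.choose_spec]; exact v.2⟩
  else if h' : ∃ i : Fin 4, (u : Site) = (v : Site) + unit i then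
    (σ ⟨((v : Site), h'.choose), v.2, by rw [← h'.choose_spec]; exact u.2⟩)⁻¹
  else 1

/-- The holonomy `σ_γ = σ_{e₁} ⋯ σ_{eₙ}` of an edge configuration along a walk. -/
def hol {Λ : Box} (σ : EdgeConf Λ G) {u v : VSite Λ}
    (w : (latticeGraph Λ).Walk u v) : G :=
  (w.darts.map fun d => oval σ d.toProd.1 d.toProd.2).prod

@[simp] lemma hol_nil {Λ : Box} (σ : EdgeConf Λ G) {u : VSite Λ} :
    hol σ (SimpleGraph.Walk.nil : (latticeGraph Λ).Walk u u) = 1 := by simp [hol]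

lemma hol_cons {Λ : Box} (σ : EdgeConf Λ G) {u m v : VSite Λ}
    (h : (latticeGraph Λ).Adj u m) (q : (latticeGraph Λ).Walk m v) :
    hol σ (SimpleGraph.Walk.cons h q) = oval σ u m * hol σ q := by
  simp [hol]

lemma hol_append {Λ : Box} (σ : EdgeConf Λ G) {u v w : VSite Λ}
    (p : (latticeGraph Λ).Walk u v) (q : (latticeGraph Λ).Walk v w) :
    hol σ (p.append q) = hol σ p * hol σ q := by
  simp [hol, SimpleGraph.Walk.darts_append]

lemma oval_mul_oval {Λ : Box} (σ : EdgeConf Λ G) {u v : VSite Λ}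
    (h : (latticeGraph Λ).Adj u v) : oval σ u v * oval σ v u = 1 := by
  obtain ⟨i, hi | hi⟩ := h
  · have h1 : ∃ k : Fin 4, (v : Site) = (u : Site) + unit k := ⟨i, hi⟩
    have h2 : ¬ ∃ k : Fin 4, (u : Site) = (v : Site) + unit k := by
      rintro ⟨k, hk⟩; exact not_both hi hk
    simp only [oval]
    rw [dif_pos h1, dif_neg h2, dif_pos h1]
    exact mul_inv_cancel _
  · have h1 : ∃ k : Fin 4, (u : Site) = (v : Site) + unit k := ⟨i, hi⟩
    have h2 : ¬ ∃ k : Fin 4, (v : Site) = (u : Site) + unit k := by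
      rintro ⟨k, hk⟩; exact not_both hk hi
    simp only [oval]
    rw [dif_neg h2, dif_pos h1, dif_pos h1]
    exact inv_mul_cancel _

/-- One step of combinatorial homotopy of walks in the 1-skeleton:
inserting or removing a backtracking `e e⁻¹`. -/
inductive HStep {Λ : Box} :
    {u v : VSite Λ} → (latticeGraph Λ).Walk u v → (latticeGraph Λ).Walk u v → Prop
  | mk {u x y v : VSite Λ} (p : (latticeGraph Λ).Walk u x) (h : (latticeGraph Λ).Adj x y)
      (q : (latticeGraph Λ).Walk x v) :
      HStep (p.append (SimpleGraph.Walk.cons h (SimpleGraph.Walk.cons h.symm q)))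
        (p.append q)

/-- Two walks in the 1-skeleton are homotopic if they differ by finitely many
insertions/removals of backtrackings.  The equivalence classes of closed walks based
at `x₀` are exactly the elements of the fundamental group `π₁(S₁(Λ), x₀)`. -/
def Homotopic {Λ : Box} {u v : VSite Λ}
    (w₁ w₂ : (latticeGraph Λ).Walk u v) : Prop :=
  Relation.EqvGen (@HStep Λ u v) w₁ w₂

lemma hol_of_hstep {Λ : Box} (σ : EdgeConf Λ G) {u v : VSite Λ}
    {w₁ w₂ : (latticeGraph Λ).Walk u v} (h : HStep w₁ w₂) : hol σ w₁ = hol σ w₂ := by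
  cases h with
  | mk p had q =>
    simp only [hol_append, hol_cons, ← mul_assoc]
    rw [mul_assoc (hol σ p), oval_mul_oval σ had, mul_one]

lemma hol_homotopic {Λ : Box} (σ : EdgeConf Λ G) {u v : VSite Λ}
    {w₁ w₂ : (latticeGraph Λ).Walk u v} (h : Homotopic w₁ w₂) : hol σ w₁ = hol σ w₂ := by
  induction h with
  | rel _ _ hs => exact hol_of_hstep σ hs
  | refl _ => rfl
  | symm _ _ _ ih => exact ih.symm
  | trans _ _ _ _ _ ih₁ ih₂ => exact ih₁.trans ih₂

/-- The set `Ω = Hom(π₁(S₁(Λ), x₀), G)` of homomorphisms from the fundamental group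
of the 1-skeleton based at `x₀` to `G`, modelled as functions on closed walks at `x₀`
that are homotopy invariant and multiplicative under concatenation. -/
structure Hom (Λ : Box) (x₀ : VSite Λ) (G : Type*) [Group G] where
  toFun : (latticeGraph Λ).Walk x₀ x₀ → G
  invariant : ∀ w₁ w₂ : (latticeGraph Λ).Walk x₀ x₀, Homotopic w₁ w₂ → toFun w₁ = toFun w₂
  map_mul : ∀ w₁ w₂ : (latticeGraph Λ).Walk x₀ x₀, toFun (w₁.append w₂) = toFun w₁ * toFun w₂

/-- The map `ψ_{x₀} : G^{Λ₁} → Ω` sending an edge configuration to the induced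
homomorphism of the fundamental group, given by holonomy along loops. -/
def psi (Λ : Box) (x₀ : VSite Λ) (σ : EdgeConf Λ G) : Hom Λ x₀ G where
  toFun := hol σ
  invariant := fun _ _ h => hol_homotopic σ h
  map_mul := fun w₁ w₂ => hol_append σ w₁ w₂


/-- The set `Λ₂` of plaquettes of `Λ`: unit squares, given by a base site and two
distinct directions, all four of whose corners (hence all four boundary edges) lie in `Λ`. -/
abbrev Plaq (Λ : Box) : Type :=
  {q : Site × Fin 4 × Fin 4 //
    q.2.1 < q.2.2 ∧ Λ.mem q.1 ∧ Λ.mem (q.1 + unit q.2.1) ∧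
    Λ.mem (q.1 + unit q.2.1 + unit q.2.2) ∧ Λ.mem (q.1 + unit q.2.2)}

namespace Plaq

variable {Λ : Box}

/-- First corner `x₁` of a plaquette. -/
def c0 (p : Plaq Λ) : VSite Λ := ⟨p.1.1, p.2.2.1⟩
/-- Second corner `x₂` of a plaquette. -/
def c1 (p : Plaq Λ) : VSite Λ := ⟨p.1.1 + unit p.1.2.1, p.2.2.2.1⟩
/-- Third corner `x₃` of a plaquette. -/
def c2 (p : Plaq Λ) : VSite Λ := ⟨p.1.1 + unit p.1.2.1 + unit p.1.2.2, p.2.2.2.2.1⟩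
/-- Fourth corner `x₄` of a plaquette. -/
def c3 (p : Plaq Λ) : VSite Λ := ⟨p.1.1 + unit p.1.2.2, p.2.2.2.2.2⟩

/-- A site is a corner (vertex) of the plaquette. -/
def isCorner (p : Plaq Λ) (x : Site) : Prop :=
  x = (p.c0 : Site) ∨ x = (p.c1 : Site) ∨ x = (p.c2 : Site) ∨ x = (p.c3 : Site)

lemma adj01 (p : Plaq Λ) : (latticeGraph Λ).Adj p.c0 p.c1 := ⟨p.1.2.1, Or.inl rfl⟩
lemma adj12 (p : Plaq Λ) : (latticeGraph Λ).Adj p.c1 p.c2 := ⟨p.1.2.2, Or.inl rfl⟩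
lemma adj23 (p : Plaq Λ) : (latticeGraph Λ).Adj p.c2 p.c3 :=
  ⟨p.1.2.1, Or.inr (add_right_comm p.1.1 (unit p.1.2.1) (unit p.1.2.2))⟩
lemma adj30 (p : Plaq Λ) : (latticeGraph Λ).Adj p.c3 p.c0 := ⟨p.1.2.2, Or.inr rfl⟩

end Plaq

/-- The counter-clockwise boundary loop `γ_p : x₁ → x₂ → x₃ → x₄ → x₁` of a plaquette. -/
def plaqWalk {Λ : Box} (p : Plaq Λ) : (latticeGraph Λ).Walk p.c0 p.c0 :=
  SimpleGraph.Walk.cons p.adj01 (SimpleGraph.Walk.cons p.adj12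
    (SimpleGraph.Walk.cons p.adj23 (SimpleGraph.Walk.cons p.adj30 SimpleGraph.Walk.nil)))

variable {G : Type*} [Group G]

/-- The plaquette variable `σ_p`: the holonomy of `σ` around the boundary of `p`. -/
def holP {Λ : Box} (σ : EdgeConf Λ G) (p : Plaq Λ) : G := hol σ (plaqWalk p)

/-- The support of an edge configuration: the plaquettes `p` with `σ_p ≠ 1`. -/
def esupp {Λ : Box} (σ : EdgeConf Λ G) : Set (Plaq Λ) := {p | holP σ p ≠ 1}

/-- The character `χ = Tr ρ` of a unitary representation `ρ` of `G` of dimension `d`. -/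
def chi {G : Type*} [Group G] {d : ℕ} (ρ : G →* Matrix.unitaryGroup (Fin d) ℂ) (g : G) : ℂ :=
  Matrix.trace ((ρ g : Matrix (Fin d) (Fin d) ℂ))

/-- `Δ_G := min_{g ≠ 1} Re (χ(1) - χ(g))`. -/
def DeltaG (G : Type*) [Group G] (χ : G → ℂ) : ℝ :=
  sInf ((fun g => (χ 1 - χ g).re) '' {g : G | g ≠ 1})

/-- `φ_β(g) = exp(-β Re(χ(1) - χ(g)))`. -/
def phiB {G : Type*} [Group G] (χ : G → ℂ) (β : ℝ) (g : G) : ℝ :=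
  Real.exp (-(β * (χ 1 - χ g).re))

/-- The Wilson action `S_Λ(σ) = Σ_{p ∈ Λ₂} Re (χ(1) - χ(σ_p))`. -/
def action (Λ : Box) (χ : G → ℂ) (σ : EdgeConf Λ G) : ℝ :=
  ∑ᶠ p : Plaq Λ, (χ 1 - χ (holP σ p)).re

/-- The partition function `Z_{Λ,β}` of the lattice gauge theory. -/
def muZ (Λ : Box) (G : Type*) [Group G] (χ : G → ℂ) (β : ℝ) : ℝ :=
  ∑ᶠ σ : EdgeConf Λ G, Real.exp (-(β * action Λ χ σ))

/-- The probability `μ_{Λ,β}(σ) = Z⁻¹ e^{-β S_Λ(σ)}` of an edge configuration. -/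
def muP (Λ : Box) (χ : G → ℂ) (β : ℝ) (σ : EdgeConf Λ G) : ℝ :=
  Real.exp (-(β * action Λ χ σ)) / muZ Λ G χ β

/-- Expectation `E[f(Σ)]` for `Σ ∼ μ_{Λ,β}`. -/
def muE (Λ : Box) (χ : G → ℂ) (β : ℝ) (f : EdgeConf Λ G → ℂ) : ℂ :=
  ∑ᶠ σ : EdgeConf Λ G, (muP Λ χ β σ : ℂ) * f σ

/-- Covariance `Cov(f(Σ), g(Σ))` for `Σ ∼ μ_{Λ,β}`. -/
def muCov (Λ : Box) (χ : G → ℂ) (β : ℝ) (f g : EdgeConf Λ G → ℂ) : ℂ :=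
  muE Λ χ β (fun σ => f σ * g σ) - muE Λ χ β f * muE Λ χ β g

section HomSide

variable (Λ : Box) (x₀ : VSite Λ)

/-- Given fixed paths `ℓ(x₀,x)` and a closed loop `γ` based at `u`, the loop
`ξ_γ = ℓ(x₀,u) γ ℓ(x₀,u)⁻¹ ∈ π₁(S₁(Λ), x₀)` (as a based closed walk). -/
def xiLoop (ℓb : ∀ x : VSite Λ, (latticeGraph Λ).Walk x₀ x) {u : VSite Λ}
    (γ : (latticeGraph Λ).Walk u u) : (latticeGraph Λ).Walk x₀ x₀ :=
  (ℓb u).append (γ.append (ℓb u).reverse)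

variable {Λ x₀}

/-- `ψ(ξ_γ)` for a homomorphism `ψ ∈ Ω` and a closed loop `γ`. -/
def evalLoop (ψ : Hom Λ x₀ G) (ℓb : ∀ x : VSite Λ, (latticeGraph Λ).Walk x₀ x)
    {u : VSite Λ} (γ : (latticeGraph Λ).Walk u u) : G :=
  ψ.toFun (xiLoop Λ x₀ ℓb γ)

/-- `ψ(ξ_p)` for a plaquette `p`. -/
def evalP (ψ : Hom Λ x₀ G) (ℓb : ∀ x : VSite Λ, (latticeGraph Λ).Walk x₀ x)
    (p : Plaq Λ) : G :=
  evalLoop ψ ℓb (plaqWalk p)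

/-- The support `supp(ψ) = {p ∈ Λ₂ : ψ(ξ_p) ≠ 1}` of a homomorphism. -/
def hsupp (ψ : Hom Λ x₀ G) (ℓb : ∀ x : VSite Λ, (latticeGraph Λ).Walk x₀ x) :
    Set (Plaq Λ) :=
  {p | evalP ψ ℓb p ≠ 1}

variable (Λ x₀)

/-- The (unnormalized) weight `∏_{p ∈ Λ₂} φ_β(ψ(ξ_p))` of a homomorphism. -/
def nuW (χ : G → ℂ) (β : ℝ) (ℓb : ∀ x : VSite Λ, (latticeGraph Λ).Walk x₀ x)
    (ψ : Hom Λ x₀ G) : ℝ :=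
  ∏ᶠ p : Plaq Λ, phiB χ β (evalP ψ ℓb p)

/-- The normalizing constant `Z^ν_{Λ,β}`. -/
def nuZ (G : Type*) [Group G] (χ : G → ℂ) (β : ℝ)
    (ℓb : ∀ x : VSite Λ, (latticeGraph Λ).Walk x₀ x) : ℝ :=
  ∑ᶠ ψ : Hom Λ x₀ G, nuW Λ x₀ χ β ℓb ψ

/-- The probability `ν_{Λ,β}(ψ)` of a homomorphism. -/
def nuP (χ : G → ℂ) (β : ℝ) (ℓb : ∀ x : VSite Λ, (latticeGraph Λ).Walk x₀ x)
    (ψ : Hom Λ x₀ G) : ℝ :=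
  nuW Λ x₀ χ β ℓb ψ / nuZ Λ x₀ G χ β ℓb

/-- Expectation `E[h(Ψ)]` for `Ψ ∼ ν_{Λ,β}`. -/
def nuE (χ : G → ℂ) (β : ℝ) (ℓb : ∀ x : VSite Λ, (latticeGraph Λ).Walk x₀ x)
    (h : Hom Λ x₀ G → ℂ) : ℂ :=
  ∑ᶠ ψ : Hom Λ x₀ G, (nuP Λ x₀ χ β ℓb ψ : ℂ) * h ψ

/-- Covariance `Cov(h₁(Ψ), h₂(Ψ))` for `Ψ ∼ ν_{Λ,β}`. -/
def nuCov (χ : G → ℂ) (β : ℝ) (ℓb : ∀ x : VSite Λ, (latticeGraph Λ).Walk x₀ x)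
    (h₁ h₂ : Hom Λ x₀ G → ℂ) : ℂ :=
  nuE Λ x₀ χ β ℓb (fun ψ => h₁ ψ * h₂ ψ) - nuE Λ x₀ χ β ℓb h₁ * nuE Λ x₀ χ β ℓb h₂

/-- For `Ψ₁, Ψ₂` i.i.d. `∼ ν_{Λ,β}`, the probability `P((Ψ₁,Ψ₂) ∈ S)`. -/
def nuP2 (χ : G → ℂ) (β : ℝ) (ℓb : ∀ x : VSite Λ, (latticeGraph Λ).Walk x₀ x)
    (S : Set (Hom Λ x₀ G × Hom Λ x₀ G)) : ℝ :=
  ∑ᶠ pr ∈ S, nuP Λ x₀ χ β ℓb pr.1 * nuP Λ x₀ χ β ℓb pr.2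

end HomSide

/-- Conjugacy invariance: `f(h₁⁻¹g₁h₁, …, h_k⁻¹g_kh_k) = f(g₁, …, g_k)`. -/
def ConjInvariant {G : Type*} [Group G] {k : ℕ} (f : (Fin k → G) → ℂ) : Prop :=
  ∀ g h : Fin k → G, f (fun i => (h i)⁻¹ * g i * h i) = f g

/-- The sup norm `‖f‖_∞` of a complex-valued function. -/
def supNorm {α : Type*} (f : α → ℂ) : ℝ := ⨆ x, ‖f x‖


/-- A rectangle `B = [x₁,y₁] × ⋯ × [x₄,y₄]` contained in `Λ` (degenerate sides allowed). -/
structure Rect (Λ : Box) where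
  lo : Fin 4 → ℤ
  hi : Fin 4 → ℤ
  lo_le_hi : ∀ i, lo i ≤ hi i
  a_le_lo : ∀ i, Λ.a i ≤ lo i
  hi_le_b : ∀ i, hi i ≤ Λ.b i

namespace Rect

variable {Λ : Box}

/-- A site is a vertex of the rectangle. -/
def memV (B : Rect Λ) (x : Site) : Prop := ∀ i, B.lo i ≤ x i ∧ x i ≤ B.hi i

/-- A plaquette is contained in the rectangle (all four corners are vertices of it). -/
def plaqIn (B : Rect Λ) (p : Plaq Λ) : Prop :=
  B.memV (p.c0 : Site) ∧ B.memV (p.c1 : Site) ∧ B.memV (p.c2 : Site) ∧ B.memV (p.c3 : Site)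

/-- The set of plaquettes contained in the rectangle. -/
def plaqSet (B : Rect Λ) : Set (Plaq Λ) := {p | B.plaqIn p}

/-- `|B|`: the number of plaquettes contained in the rectangle. -/
def plaqCard (B : Rect Λ) : ℕ := Nat.card B.plaqSet

end Rect

/-- A walk is contained in a rectangle if all its vertices are vertices of the rectangle. -/
def WalkInRect {Λ : Box} (B : Rect Λ) {u v : VSite Λ}
    (w : (latticeGraph Λ).Walk u v) : Prop :=
  ∀ x ∈ w.support, B.memV (x : Site)

/-- The four boundary edges of a plaquette (as ordered pairs of vertices). -/
def plaqEdges {Λ : Box} (p : Plaq Λ) : List (VSite Λ × VSite Λ) :=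
  [(p.c0, p.c1), (p.c1, p.c2), (p.c3, p.c2), (p.c0, p.c3)]

/-- `(u,v)` is an (unoriented) edge of the 2-complex generated by the plaquette set `Q`. -/
def edgeInComplex {Λ : Box} (Q : Set (Plaq Λ)) (u v : VSite Λ) : Prop :=
  ∃ p ∈ Q, (u, v) ∈ plaqEdges p ∨ (v, u) ∈ plaqEdges p

/-- `u` is a vertex of the 2-complex generated by the plaquette set `Q`. -/
def vertexInComplex {Λ : Box} (Q : Set (Plaq Λ)) (u : VSite Λ) : Prop :=
  ∃ p ∈ Q, u = p.c0 ∨ u = p.c1 ∨ u = p.c2 ∨ u = p.c3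

/-- A walk lies in the 2-complex generated by `Q` if all its vertices and edges do. -/
def WalkInComplex {Λ : Box} (Q : Set (Plaq Λ)) {u v : VSite Λ}
    (w : (latticeGraph Λ).Walk u v) : Prop :=
  (∀ x ∈ w.support, vertexInComplex Q x) ∧
  (∀ d ∈ w.darts, edgeInComplex Q d.toProd.1 d.toProd.2)

/-- One step of combinatorial homotopy of walks within the 2-complex generated by `Q`:
inserting/removing a backtracking along an edge of the complex, or inserting/removing the
boundary loop of a plaquette of the complex. -/
inductive CHStep {Λ : Box} (Q : Set (Plaq Λ)) :
    {u v : VSite Λ} → (latticeGraph Λ).Walk u v → (latticeGraph Λ).Walk u v → Prop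
  | back {u x y v : VSite Λ} (p : (latticeGraph Λ).Walk u x) (h : (latticeGraph Λ).Adj x y)
      (he : edgeInComplex Q x y) (q : (latticeGraph Λ).Walk x v) :
      CHStep Q (p.append (SimpleGraph.Walk.cons h (SimpleGraph.Walk.cons h.symm q)))
        (p.append q)
  | plaq {u v : VSite Λ} (pl : Plaq Λ) (hpl : pl ∈ Q)
      (w₁ : (latticeGraph Λ).Walk u pl.c0) (w₂ : (latticeGraph Λ).Walk pl.c0 v) :
      CHStep Q (w₁.append ((plaqWalk pl).append w₂)) (w₁.append w₂)

/-- Homotopy of walks within the 2-complex generated by `Q`. -/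
def CHomotopic {Λ : Box} (Q : Set (Plaq Λ)) {u v : VSite Λ}
    (w₁ w₂ : (latticeGraph Λ).Walk u v) : Prop :=
  Relation.EqvGen (@CHStep Λ Q u v) w₁ w₂

/-- A 2-complex (given by a plaquette set `Q`, together with all its edges and vertices)
is simply connected: it is path connected and every closed walk in it is null-homotopic
within it. -/
def SimplyConnectedC {Λ : Box} (Q : Set (Plaq Λ)) : Prop :=
  (∀ u v : VSite Λ, vertexInComplex Q u → vertexInComplex Q v →
     ∃ w : (latticeGraph Λ).Walk u v, WalkInComplex Q w) ∧
  (∀ u : VSite Λ, ∀ w : (latticeGraph Λ).Walk u u, WalkInComplex Q w →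
     CHomotopic Q w SimpleGraph.Walk.nil)

/-- The 2-complex `S₂(B)`: all plaquettes of the rectangle `B`. -/
def S2 {Λ : Box} (B : Rect Λ) : Set (Plaq Λ) := B.plaqSet

/-- A plaquette lies on the (topological) boundary of a rectangle. -/
def Plaq.onRectBoundary {Λ : Box} (B : Rect Λ) (p : Plaq Λ) : Prop :=
  B.plaqIn p ∧ ∃ k : Fin 4, k ≠ p.1.2.1 ∧ k ≠ p.1.2.2 ∧
    (p.1.1 k = B.lo k ∨ p.1.1 k = B.hi k)

/-- A plaquette lies on the boundary of the lattice `Λ`. -/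
def Plaq.onBoxBoundary {Λ : Box} (p : Plaq Λ) : Prop :=
  ∃ k : Fin 4, k ≠ p.1.2.1 ∧ k ≠ p.1.2.2 ∧ (p.1.1 k = Λ.a k ∨ p.1.1 k = Λ.b k)

/-- The 2-complex `∂S₂(B)`: plaquettes on the boundary of `B` but not on the boundary of `Λ`. -/
def bS2 {Λ : Box} (B : Rect Λ) : Set (Plaq Λ) :=
  {p | p.onRectBoundary B ∧ ¬ p.onBoxBoundary}

/-- The 2-complex `S₂ᶜ(B)`: all plaquettes of `Λ` not contained in `B`, together with `∂S₂(B)`. -/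
def S2c {Λ : Box} (B : Rect Λ) : Set (Plaq Λ) :=
  {p | ¬ B.plaqIn p} ∪ bS2 B

/-- `P₁, P₂` are well separated by the rectangle `B`. -/
def WellSeparated {Λ : Box} (B : Rect Λ) (P₁ P₂ : Set (Plaq Λ)) : Prop :=
  P₁ ⊆ S2 B ∧ P₂ ⊆ S2c B ∧ ∀ p ∈ P₁ ∪ P₂, p ∉ bS2 B

/-- A good rectangle: `S₂(B)`, `S₂ᶜ(B)` and `∂S₂(B)` are all simply connected. -/
def GoodRect {Λ : Box} (B : Rect Λ) : Prop :=
  SimplyConnectedC (S2 B) ∧ SimplyConnectedC (S2c B) ∧ SimplyConnectedC (bS2 B)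

/-- `P₁` is well separated from `P₂` by some good rectangle. -/
def WellSepGood {Λ : Box} (P₁ P₂ : Set (Plaq Λ)) : Prop :=
  ∃ B : Rect Λ, GoodRect B ∧ WellSeparated B P₁ P₂

/-- Union of a list of sets. -/
def unionList {α : Type*} (Ks : List (Set α)) : Set α := {x | ∃ K ∈ Ks, x ∈ K}

/-- `Ks` is a knot decomposition of the plaquette set `P`: a maximal partition
`P = K₁ ∪ ⋯ ∪ K_m` such that each `K_i` is well separated from `K_{i+1} ∪ ⋯ ∪ K_m`
by a good rectangle. -/
structure IsKnotDecomp {Λ : Box} (P : Set (Plaq Λ)) (Ks : List (Set (Plaq Λ))) : Prop where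
  union_eq : unionList Ks = P
  nonempty : ∀ K ∈ Ks, K.Nonempty
  pairwise_disjoint : Ks.Pairwise Disjoint
  sep : ∀ (n : ℕ) (hn : n + 1 < Ks.length),
    WellSepGood (Ks.get ⟨n, Nat.lt_of_succ_lt hn⟩) (unionList (Ks.drop (n + 1)))
  maximal : ∀ K ∈ Ks, ¬ ∃ K₁ K₂ : Set (Plaq Λ), K₁.Nonempty ∧ K₂.Nonempty ∧
    Disjoint K₁ K₂ ∧ K₁ ∪ K₂ = K ∧ WellSepGood K₁ K₂

/-- The collection `𝒦` of knots: all sets appearing in the (fixed) knot decomposition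
`KD P` of some plaquette set `P`. -/
def Knots {Λ : Box} (KD : Set (Plaq Λ) → List (Set (Plaq Λ))) : Set (Set (Plaq Λ)) :=
  {K | ∃ P : Set (Plaq Λ), K ∈ KD P}

/-- `GF(T)`: edge configurations equal to `1` on every edge of the graph `T`. -/
def GF {Λ : Box} (G : Type*) [Group G] (T : SimpleGraph (VSite Λ)) :
    Set (EdgeConf Λ G) :=
  {σ | ∀ e : PEdge Λ, T.Adj e.v0 e.v1 → σ e = 1}

/-- The 1-skeleton of the 2-complex generated by the plaquette set `Q`, as a graph. -/
def skel {Λ : Box} (Q : Set (Plaq Λ)) : SimpleGraph (VSite Λ) :=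
  SimpleGraph.fromRel (edgeInComplex Q)

/-- `T` is a spanning tree of the 1-skeleton `S₁(Λ)`. -/
def IsSpanningTree {Λ : Box} (T : SimpleGraph (VSite Λ)) : Prop :=
  T ≤ latticeGraph Λ ∧ T.IsTree

/-- `T` contains a spanning tree of the 2-complex generated by `Q`: any two vertices of the
complex are joined by a path using only edges lying both in `T` and in the complex. -/
def ContainsSpanningTreeOf {Λ : Box} (T : SimpleGraph (VSite Λ)) (Q : Set (Plaq Λ)) : Prop :=
  ∀ u v : VSite Λ, vertexInComplex Q u → vertexInComplex Q v → (T ⊓ skel Q).Reachable u v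

section Phi

variable (Λ : Box) (x₀ : VSite Λ) {G : Type*} [Group G]

/-- `supp_{P₀}(ψ₁, ψ₂) = supp(ψ₁) ∪ supp(ψ₂) ∪ P₀`. -/
def supp2 (ℓb : ∀ x : VSite Λ, (latticeGraph Λ).Walk x₀ x) (P₀ : Set (Plaq Λ))
    (ψ₁ ψ₂ : Hom Λ x₀ G) : Set (Plaq Λ) :=
  hsupp ψ₁ ℓb ∪ hsupp ψ₂ ℓb ∪ P₀

/-- The polymer counting function
`Φ²_{P₀}(P) = Σ_{ψ₁,ψ₂ : supp_{P₀}(ψ₁,ψ₂) = P} ∏_{p∈Λ₂} φ_β(ψ₁(ξ_p)) φ_β(ψ₂(ξ_p))`. -/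
def Phi2 (χ : G → ℂ) (β : ℝ) (ℓb : ∀ x : VSite Λ, (latticeGraph Λ).Walk x₀ x)
    (P₀ P : Set (Plaq Λ)) : ℝ :=
  ∑ᶠ pr : Hom Λ x₀ G × Hom Λ x₀ G,
    if supp2 Λ x₀ ℓb P₀ pr.1 pr.2 = P then
      ∏ᶠ p : Plaq Λ, phiB χ β (evalP pr.1 ℓb p) * phiB χ β (evalP pr.2 ℓb p)
    else 0

end Phi


section Swap

variable (Λ : Box) (x₀ : VSite Λ) (G : Type*) [Group G]

/-- Tuples of homomorphisms subordinate to the members of a list of plaquette sets. -/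
def TupleSpace (ℓb : ∀ x : VSite Λ, (latticeGraph Λ).Walk x₀ x)
    (Ks : List (Set (Plaq Λ))) : Type _ :=
  {t : Fin Ks.length → Hom Λ x₀ G // ∀ i, hsupp (t i) ℓb ⊆ Ks.get i}

/-- `P := supp(ψ₁) ∪ supp(ψ₂) ∪ B₁ ∪ B₂` for a pair of homomorphisms. -/
def bigP (ℓb : ∀ x : VSite Λ, (latticeGraph Λ).Walk x₀ x) (B₁ B₂ : Rect Λ)
    (pr : Hom Λ x₀ G × Hom Λ x₀ G) : Set (Plaq Λ) :=
  hsupp pr.1 ℓb ∪ hsupp pr.2 ℓb ∪ S2 B₁ ∪ S2 B₂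

/-- `B₁` and `B₂` lie in different knots of the knot decomposition of
`supp(ψ₁) ∪ supp(ψ₂) ∪ B₁ ∪ B₂`. -/
def inDiffKnots (KD : Set (Plaq Λ) → List (Set (Plaq Λ)))
    (ℓb : ∀ x : VSite Λ, (latticeGraph Λ).Walk x₀ x) (B₁ B₂ : Rect Λ)
    (pr : Hom Λ x₀ G × Hom Λ x₀ G) : Prop :=
  ∃ j₁ j₂ : Fin (KD (bigP Λ x₀ G ℓb B₁ B₂ pr)).length, j₁ ≠ j₂ ∧
    S2 B₁ ⊆ (KD (bigP Λ x₀ G ℓb B₁ B₂ pr)).get j₁ ∧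
    S2 B₂ ⊆ (KD (bigP Λ x₀ G ℓb B₁ B₂ pr)).get j₂

/-- The event `E(B₁,B₂) ⊆ Ω²`. -/
def Eset (KD : Set (Plaq Λ) → List (Set (Plaq Λ)))
    (ℓb : ∀ x : VSite Λ, (latticeGraph Λ).Walk x₀ x) (B₁ B₂ : Rect Λ) :
    Set (Hom Λ x₀ G × Hom Λ x₀ G) :=
  {pr | inDiffKnots Λ x₀ G KD ℓb B₁ B₂ pr}

/-- The swapping map `T : E(B₁,B₂) → E(B₁,B₂)` (extended by the identity off `E(B₁,B₂)`):
identify `ψ₁, ψ₂` with tuples via `Θ(P)`, exchange the coordinates of the knot containing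
`B₂`, and come back via `Θ(P)⁻¹`. -/
def swapT (KD : Set (Plaq Λ) → List (Set (Plaq Λ)))
    (ℓb : ∀ x : VSite Λ, (latticeGraph Λ).Walk x₀ x)
    (Θ : ∀ P : Set (Plaq Λ),
      {ψ : Hom Λ x₀ G // hsupp ψ ℓb ⊆ P} ≃ TupleSpace Λ x₀ G ℓb (KD P))
    (B₁ B₂ : Rect Λ) (pr : Hom Λ x₀ G × Hom Λ x₀ G) : Hom Λ x₀ G × Hom Λ x₀ G :=
  if h : inDiffKnots Λ x₀ G KD ℓb B₁ B₂ pr then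
    let P := bigP Λ x₀ G ℓb B₁ B₂ pr
    let j₂ : Fin (KD P).length := h.choose_spec.choose
    let t₁ := Θ P ⟨pr.1, fun p hp =>
      Set.mem_union_left _ (Set.mem_union_left _ (Set.mem_union_left _ hp))⟩
    let t₂ := Θ P ⟨pr.2, fun p hp =>
      Set.mem_union_left _ (Set.mem_union_left _ (Set.mem_union_right _ hp))⟩
    (((Θ P).symm ⟨Function.update t₁.1 j₂ (t₂.1 j₂), by
        intro i
        rcases eq_or_ne i j₂ with hi | hi
        · subst hi; rw [Function.update_self]; exact t₂.2 j₂
        · rw [Function.update_of_ne hi]; exact t₁.2 i⟩).1,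
     ((Θ P).symm ⟨Function.update t₂.1 j₂ (t₁.1 j₂), by
        intro i
        rcases eq_or_ne i j₂ with hi | hi
        · subst hi; rw [Function.update_self]; exact t₁.2 j₂
        · rw [Function.update_of_ne hi]; exact t₂.2 i⟩).1)
  else pr

end Swap


lemma unit_injective : Function.Injective unit := by
  intro i j h
  have h1 := congrFun h i
  rw [unit_apply_self] at h1
  by_contra hne
  simp [unit, hne] at h1

lemma PEdge.adj {Λ : Box} (e : PEdge Λ) : (latticeGraph Λ).Adj e.v0 e.v1 :=
  ⟨e.1.2, Or.inl rfl⟩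

lemma oval_pos {Λ : Box} {G : Type*} [Group G] (σ : EdgeConf Λ G) (e : PEdge Λ) :
    oval σ e.v0 e.v1 = σ e := by
  have h : ∃ i : Fin 4, (e.v1 : Site) = (e.v0 : Site) + unit i := ⟨e.1.2, rfl⟩
  simp only [oval]
  rw [dif_pos h]
  congr 1
  refine Subtype.ext (Prod.ext rfl ?_)
  exact unit_injective (add_left_cancel h.choose_spec).symm

lemma exists_pEdge_of_adj {Λ : Box} {u v : VSite Λ} (h : (latticeGraph Λ).Adj u v) :
    (∃ e : PEdge Λ, e.v0 = u ∧ e.v1 = v) ∨ ∃ e : PEdge Λ, e.v0 = v ∧ e.v1 = u := by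
  obtain ⟨i, hi | hi⟩ := h
  · exact Or.inl ⟨⟨(u, i), u.2, by rw [← hi]; exact v.2⟩, rfl, Subtype.ext hi.symm⟩
  · exact Or.inr ⟨⟨(v, i), v.2, by rw [← hi]; exact u.2⟩, rfl, Subtype.ext hi.symm⟩

lemma hol_reverse {Λ : Box} {G : Type*} [Group G] (σ : EdgeConf Λ G) {u v : VSite Λ}
    (w : (latticeGraph Λ).Walk u v) : hol σ w.reverse = (hol σ w)⁻¹ := by
  induction w with
  | nil => simp
  | cons h w ih =>
    rw [Walk.reverse_cons, hol_append, hol_cons, hol_cons, hol_nil, ih, mul_one, mul_inv_rev,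
      eq_inv_of_mul_eq_one_right (oval_mul_oval σ h)]

/-- A walk followed back and forth may be cancelled up to homotopy. -/
lemma homotopic_append_reverse_append {Λ : Box} {u v x y : VSite Λ}
    (p : (latticeGraph Λ).Walk u x) (r : (latticeGraph Λ).Walk y x)
    (q : (latticeGraph Λ).Walk x v) :
    Homotopic (p.append (r.reverse.append (r.append q))) (p.append q) := by
  induction r with
  | nil => exact Relation.EqvGen.refl _
  | cons h r ih =>
    refine Relation.EqvGen.trans _ _ _ (Relation.EqvGen.rel _ _ ?_) (ih p q)
    simpa [Walk.reverse_cons, ← Walk.append_assoc] using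
      HStep.mk (p.append r.reverse) h.symm (r.append q)

section Gauge

variable {Λ : Box} {x₀ : VSite Λ} {G : Type*} [Group G]

lemma Hom.ext_toFun {ψ φ : Hom Λ x₀ G} (h : ψ.toFun = φ.toFun) : ψ = φ := by
  cases ψ; cases φ; cases h; rfl

lemma Hom.map_nil (ψ : Hom Λ x₀ G) : ψ.toFun Walk.nil = 1 := by
  have h := ψ.map_mul Walk.nil Walk.nil
  rw [Walk.nil_append] at h
  exact left_eq_mul.mp h

variable (ℓb : ∀ x : VSite Λ, (latticeGraph Λ).Walk x₀ x)

/-- `ψ(ℓ(x₀,u) w ℓ(x₀,v)⁻¹)` for a walk `w` from `u` to `v`. -/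
def Hom.along (ψ : Hom Λ x₀ G) {u v : VSite Λ} (w : (latticeGraph Λ).Walk u v) : G :=
  ψ.toFun ((ℓb u).append (w.append (ℓb v).reverse))

lemma Hom.along_append (ψ : Hom Λ x₀ G) {u v x : VSite Λ}
    (w : (latticeGraph Λ).Walk u v) (w' : (latticeGraph Λ).Walk v x) :
    ψ.along ℓb (w.append w') = ψ.along ℓb w * ψ.along ℓb w' := by
  simp only [Hom.along]
  rw [← ψ.map_mul]
  refine (ψ.invariant _ _ ?_).symm
  simpa [Walk.append_assoc] using homotopic_append_reverse_append
    ((ℓb u).append w) (ℓb v) (w'.append (ℓb x).reverse)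

lemma Hom.along_nil (ψ : Hom Λ x₀ G) (u : VSite Λ) :
    ψ.along ℓb (Walk.nil : (latticeGraph Λ).Walk u u) = 1 :=
  left_eq_mul.mp (ψ.along_append ℓb (Walk.nil : (latticeGraph Λ).Walk u u) Walk.nil)

lemma Hom.along_backtrack (ψ : Hom Λ x₀ G) {u v : VSite Λ} (h : (latticeGraph Λ).Adj u v) :
    ψ.along ℓb (Walk.cons h Walk.nil) * ψ.along ℓb (Walk.cons h.symm Walk.nil) = 1 := by
  rw [← ψ.along_append, ← ψ.along_nil ℓb u]
  exact ψ.invariant _ _ (Relation.EqvGen.rel _ _ (HStep.mk (ℓb u) h (ℓb u).reverse))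

lemma Hom.toFun_append_reverse (ψ : Hom Λ x₀ G) {x : VSite Λ}
    (w : (latticeGraph Λ).Walk x₀ x) : ψ.toFun (w.append w.reverse) = 1 := by
  rw [← ψ.map_nil]
  refine ψ.invariant _ _ ?_
  simpa using homotopic_append_reverse_append Walk.nil w.reverse Walk.nil

lemma Hom.toFun_reverse (ψ : Hom Λ x₀ G) (w : (latticeGraph Λ).Walk x₀ x₀) :
    ψ.toFun w.reverse = (ψ.toFun w)⁻¹ := by
  refine eq_inv_of_mul_eq_one_right ?_
  rw [← ψ.map_mul, ψ.toFun_append_reverse]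

lemma Hom.along_based_loop (ψ : Hom Λ x₀ G) (w : (latticeGraph Λ).Walk x₀ x₀) :
    ψ.along ℓb w = ψ.toFun (ℓb x₀) * ψ.toFun w * (ψ.toFun (ℓb x₀))⁻¹ := by
  simp only [Hom.along, ψ.map_mul, ψ.toFun_reverse, mul_assoc]

lemma Hom.along_base_path (ψ : Hom Λ x₀ G) (x : VSite Λ) :
    ψ.along ℓb (ℓb x) = ψ.toFun (ℓb x₀) := by
  rw [Hom.along, ψ.map_mul, ψ.toFun_append_reverse, mul_one]

/-- The edge configuration with holonomies `ψ` and gauge `g`. -/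
def gaugeConf (ψ : Hom Λ x₀ G) (g : VSite Λ → G) : EdgeConf Λ G := fun e =>
  (g e.v0)⁻¹ * ψ.along ℓb (Walk.cons e.adj Walk.nil) * g e.v1

lemma oval_gaugeConf (ψ : Hom Λ x₀ G) (g : VSite Λ → G) {u v : VSite Λ}
    (h : (latticeGraph Λ).Adj u v) :
    oval (gaugeConf ℓb ψ g) u v = (g u)⁻¹ * ψ.along ℓb (Walk.cons h Walk.nil) * g v := by
  obtain ⟨e, rfl, rfl⟩ | ⟨e, rfl, rfl⟩ := exists_pEdge_of_adj h
  · exact oval_pos _ e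
  · rw [eq_inv_of_mul_eq_one_left (oval_mul_oval (gaugeConf ℓb ψ g) h), oval_pos, gaugeConf,
      eq_inv_of_mul_eq_one_left (ψ.along_backtrack ℓb h)]
    group

lemma hol_gaugeConf (ψ : Hom Λ x₀ G) (g : VSite Λ → G) {u v : VSite Λ}
    (w : (latticeGraph Λ).Walk u v) :
    hol (gaugeConf ℓb ψ g) w = (g u)⁻¹ * ψ.along ℓb w * g v := by
  induction w with
  | nil => simp [Hom.along_nil]
  | @cons u m v h w ih =>
    have hw := ψ.along_append ℓb (Walk.cons h Walk.nil) w
    rw [Walk.cons_append, Walk.nil_append] at hw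
    rw [hol_cons, ih, oval_gaugeConf ℓb ψ g h, hw]
    group

lemma along_psi (σ : EdgeConf Λ G) {u v : VSite Λ} (w : (latticeGraph Λ).Walk u v) :
    (psi Λ x₀ σ).along ℓb w = hol σ (ℓb u) * hol σ w * (hol σ (ℓb v))⁻¹ := by
  simp only [Hom.along, psi, hol_append, hol_reverse, mul_assoc]

/-- Extend a gauge on the vertices other than `x₀` to all vertices, with value
`ψ(ℓ(x₀,x₀))` at `x₀`. -/
def extendGauge (ψ : Hom Λ x₀ G) (g : {x : VSite Λ // x ≠ x₀} → G) (x : VSite Λ) : G :=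
  if h : x = x₀ then ψ.toFun (ℓb x₀) else g ⟨x, h⟩

lemma extendGauge_base (ψ : Hom Λ x₀ G) (g : {x : VSite Λ // x ≠ x₀} → G) :
    extendGauge ℓb ψ g x₀ = ψ.toFun (ℓb x₀) := dif_pos rfl

lemma extendGauge_psi (σ : EdgeConf Λ G) :
    extendGauge ℓb (psi Λ x₀ σ) (fun x => hol σ (ℓb x)) = fun x => hol σ (ℓb x) := by
  funext x
  unfold extendGauge
  split_ifs with h
  · subst h; rfl
  · rfl

/-- Edge configurations correspond bijectively to a homomorphism of the fundamental group
together with a gauge at the vertices other than the base point. -/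
def edgeConfEquiv : EdgeConf Λ G ≃ Hom Λ x₀ G × ({x : VSite Λ // x ≠ x₀} → G) where
  toFun σ := (psi Λ x₀ σ, fun x => hol σ (ℓb x))
  invFun q := gaugeConf ℓb q.1 (extendGauge ℓb q.1 q.2)
  left_inv σ := by
    funext e
    simp only [extendGauge_psi]
    simp only [gaugeConf, along_psi, hol_cons, hol_nil, oval_pos]
    group
  right_inv := by
    rintro ⟨ψ, g⟩
    refine Prod.ext (Hom.ext_toFun ?_) ?_
    · funext w
      simp only [psi, hol_gaugeConf, extendGauge_base, Hom.along_based_loop]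
      group
    · funext x
      simp [hol_gaugeConf, Hom.along_base_path, extendGauge, x.2]

lemma hol_eq_conj_evalLoop (σ : EdgeConf Λ G) {u : VSite Λ} (w : (latticeGraph Λ).Walk u u) :
    hol σ w = (hol σ (ℓb u))⁻¹ * evalLoop (psi Λ x₀ σ) ℓb w * hol σ (ℓb u) := by
  have h : evalLoop (psi Λ x₀ σ) ℓb w = hol σ (ℓb u) * hol σ w * (hol σ (ℓb u))⁻¹ :=
    along_psi ℓb σ w
  rw [h]
  group

end Gauge

instance (Λ : Box) : Finite (VSite Λ) :=
  Set.Finite.to_subtype ((Set.finite_Icc Λ.a Λ.b).subset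
    fun _ hx => ⟨fun i => (hx i).1, fun i => (hx i).2⟩)

instance (Λ : Box) : Finite (PEdge Λ) :=
  Finite.of_injective (fun e : PEdge Λ => (e.v0, e.1.2)) fun _ _ h =>
    Subtype.ext (Prod.ext (congrArg Subtype.val (Prod.ext_iff.mp h).1) (Prod.ext_iff.mp h).2)

instance (Λ : Box) : Finite (Plaq Λ) :=
  Finite.of_injective (fun p : Plaq Λ => (p.c0, p.1.2)) fun _ _ h =>
    Subtype.ext (Prod.ext (congrArg Subtype.val (Prod.ext_iff.mp h).1) (Prod.ext_iff.mp h).2)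

section Expectation

variable {Λ : Box} {x₀ : VSite Λ} {G : Type*} [Group G]

lemma finite_hom [Finite G] (ℓb : ∀ x : VSite Λ, (latticeGraph Λ).Walk x₀ x) :
    Finite (Hom Λ x₀ G) :=
  Finite.of_surjective (fun σ : EdgeConf Λ G => (edgeConfEquiv ℓb σ).1)
    (Prod.fst_surjective.comp (edgeConfEquiv ℓb).surjective)

/-- Every homomorphism is induced by the same number of edge configurations. -/
lemma finsum_comp_psi [Finite G] {R : Type*} [Semiring R]
    (ℓb : ∀ x : VSite Λ, (latticeGraph Λ).Walk x₀ x) (F : Hom Λ x₀ G → R) :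
    ∑ᶠ σ : EdgeConf Λ G, F (psi Λ x₀ σ)
      = (Nat.card ({x : VSite Λ // x ≠ x₀} → G) : R) * ∑ᶠ ψ : Hom Λ x₀ G, F ψ := by
  have := finite_hom (G := G) ℓb
  have := Fintype.ofFinite (Hom Λ x₀ G)
  have := Fintype.ofFinite ({x : VSite Λ // x ≠ x₀} → G)
  have h := finsum_comp_equiv (edgeConfEquiv (G := G) ℓb) (f := fun q => F q.1)
  rw [show ∑ᶠ σ : EdgeConf Λ G, F (psi Λ x₀ σ) = ∑ᶠ q : Hom Λ x₀ G × _, F q.1 from h,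
    finsum_eq_sum_of_fintype, finsum_eq_sum_of_fintype, Fintype.sum_prod_type, Finset.mul_sum]
  simp [Nat.card_eq_fintype_card]

lemma chi_conj {d : ℕ} (ρ : G →* Matrix.unitaryGroup (Fin d) ℂ) (g h : G) :
    chi ρ (h⁻¹ * g * h) = chi ρ g := by
  have hh : (ρ h : Matrix (Fin d) (Fin d) ℂ) * (ρ h⁻¹ : Matrix (Fin d) (Fin d) ℂ) = 1 := by
    rw [← Submonoid.coe_mul, ← map_mul, mul_inv_cancel, map_one, Submonoid.coe_one]
  simp only [chi, map_mul, Submonoid.coe_mul]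
  rw [Matrix.trace_mul_comm, ← mul_assoc, hh, one_mul]

lemma exp_action_eq_nuW {d : ℕ} (ρ : G →* Matrix.unitaryGroup (Fin d) ℂ) (β : ℝ)
    (ℓb : ∀ x : VSite Λ, (latticeGraph Λ).Walk x₀ x) (σ : EdgeConf Λ G) :
    Real.exp (-(β * action Λ (chi ρ) σ)) = nuW Λ x₀ (chi ρ) β ℓb (psi Λ x₀ σ) := by
  have := Fintype.ofFinite (Plaq Λ)
  rw [action, nuW, finsum_eq_sum_of_fintype, finprod_eq_prod_of_fintype, Finset.mul_sum,
    ← Finset.sum_neg_distrib, Real.exp_sum]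
  refine Finset.prod_congr rfl fun p _ => ?_
  rw [phiB, evalP, holP, hol_eq_conj_evalLoop ℓb, chi_conj]

lemma muZ_eq_card_mul_nuZ [Finite G] {d : ℕ} (ρ : G →* Matrix.unitaryGroup (Fin d) ℂ) (β : ℝ)
    (ℓb : ∀ x : VSite Λ, (latticeGraph Λ).Walk x₀ x) :
    muZ Λ G (chi ρ) β
      = (Nat.card ({x : VSite Λ // x ≠ x₀} → G) : ℝ) * nuZ Λ x₀ G (chi ρ) β ℓb := by
  simp only [muZ, nuZ, exp_action_eq_nuW ρ β ℓb]
  exact finsum_comp_psi ℓb _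

end Expectation

/-- For conjugacy invariant `f : G^k → ℂ` and closed loops `γ₁, …, γ_k` in `Λ`,
with `Σ ∼ μ_{Λ,β}` and `Ψ ∼ ν_{Λ,β}`,
`E[f(Σ_{γ₁}, …, Σ_{γ_k})] = E[f(Ψ(ξ_{γ₁}), …, Ψ(ξ_{γ_k}))]`. -/
theorem expectation_wilson_eq
    (Λ : Box) (x₀ : VSite Λ) (G : Type*) [Group G] [Finite G]
    {d : ℕ} (ρ : G →* Matrix.unitaryGroup (Fin d) ℂ)
    (β : ℝ) (hβ : 0 ≤ β)
    (ℓb : ∀ x : VSite Λ, (latticeGraph Λ).Walk x₀ x)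
    (k : ℕ) (hk : 1 ≤ k)
    (f : (Fin k → G) → ℂ) (hf : ConjInvariant f)
    (γ : Fin k → Σ u : VSite Λ, (latticeGraph Λ).Walk u u) :
    muE Λ (chi ρ) β (fun σ => f fun j => hol σ (γ j).2)
      = nuE Λ x₀ (chi ρ) β ℓb (fun ψ => f fun j => evalLoop ψ ℓb (γ j).2) := by
  have hN : (Nat.card ({x : VSite Λ // x ≠ x₀} → G) : ℂ) ≠ 0 :=
    Nat.cast_ne_zero.mpr Nat.card_pos.ne'
  have hF : ∀ σ : EdgeConf Λ G, (f fun j => hol σ (γ j).2)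
      = f fun j => evalLoop (psi Λ x₀ σ) ℓb (γ j).2 := fun σ =>
    (congrArg f (funext fun j => hol_eq_conj_evalLoop ℓb σ (γ j).2)).trans
      (hf _ fun j => hol σ (ℓb (γ j).1))
  simp only [muE, nuE, muP, nuP, hF, exp_action_eq_nuW ρ β ℓb, muZ_eq_card_mul_nuZ ρ β ℓb]
  rw [finsum_comp_psi ℓb fun ψ : Hom Λ x₀ G =>
    ((nuW Λ x₀ (chi ρ) β ℓb ψ / ((Nat.card ({x : VSite Λ // x ≠ x₀} → G) : ℝ)
      * nuZ Λ x₀ G (chi ρ) β ℓb) : ℝ) : ℂ) * f fun j => evalLoop ψ ℓb (γ j).2]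
  have := finite_hom (G := G) ℓb
  have := Fintype.ofFinite (Hom Λ x₀ G)
  rw [finsum_eq_sum_of_fintype, finsum_eq_sum_of_fintype, Finset.mul_sum]
  refine Finset.sum_congr rfl fun ψ _ => ?_
  push_cast
  rw [← mul_assoc, ← mul_div_assoc, mul_div_mul_left _ _ hN]

end LGT
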